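/- arXiv:2210.06181 — 12 statements merged into one kernel-verified Lean document; each statement's English description precedes it below -/
import Mathlib

section
/- Let S be a semigroup, σ:S→S an involutive automorphism, β∈ℂ∖{0}, and f:S→ℂ a nonzero function satisfying f(xσ(y)) = β f(x) f(y) for all x,y∈S. Then the function χ := βf is a nonzero multiplicative function on S and χ∘σ = χ. -/
/-- if `f ≠ 0` satisfies `f(xσ(y)) = β f(x) f(y)` with `β ≠ 0`, then
`χ := βf` is a nonzero multiplicative function with `χ ∘ σ = χ`. -/
theorem stmt_1 {S : Type*} [Semigroup S] (σ : S → S)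
    (hσmul : ∀ x y : S, σ (x * y) = σ x * σ y) (hσinv : ∀ x : S, σ (σ x) = x)
    (β : ℂ) (hβ : β ≠ 0) (f : S → ℂ) (hf : f ≠ 0)
    (hfe : ∀ x y : S, f (x * σ y) = β * f x * f y) :
    (∀ x y : S, β * f (x * y) = (β * f x) * (β * f y)) ∧
    (fun x => β * f x) ≠ (0 : S → ℂ) ∧
    (∀ x : S, β * f (σ x) = β * f x) := by
  obtain ⟨a, ha⟩ := Function.ne_iff.mp hf
  have ha : f a ≠ 0 := ha
  have h : ∀ x y, f (x * y) = β * f x * f (σ y) := fun x y => by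
    rw [← hfe, hσinv]
  have hs : ∀ z, f (σ z) = f z := fun z => by
    have h1 : f (a * σ a * z) = β * (β * f a * f a) * f (σ z) := by
      rw [h, hfe]
    have h2 : f (a * σ a * z) = β * f a * (β * f a * f z) := by
      rw [mul_assoc, h, hσmul, hσinv, hfe]
    have h3 : (β * β * f a * f a) * f (σ z) = (β * β * f a * f a) * f z := by
      linear_combination h2 - h1
    exact mul_left_cancel₀ (by simp [hβ, ha]) h3
  refine ⟨fun x y => ?_, fun h0 => ?_, fun x => by rw [hs]⟩
  · rw [h, hs]; ring
  · have := congrFun h0 a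
    simp [hβ, ha] at this
end

section
/- Let S be a semigroup and σ:S→S an involutive automorphism. If f,g:S→ℂ satisfy g(xσ(y)) = g(x)g(y) + f(x)f(y) for all x,y∈S, then both f and g are abelian; that is, f(xy)=f(yx), g(xy)=g(yx), f(xyz)=f(xzy), and g(xyz)=g(xzy) for all x,y,z∈S. -/
theorem aux_cancel {g1 f1 g2 f2 α β : ℂ} (hD : g1 * f2 - g2 * f1 ≠ 0)
    (h1 : α * g1 + β * f1 = 0) (h2 : α * g2 + β * f2 = 0) : α = 0 ∧ β = 0 := by
  constructor
  · apply (mul_eq_zero.mp (?_ : (g1 * f2 - g2 * f1) * α = 0)).resolve_left hD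
    linear_combination f2 * h1 - f1 * h2
  · apply (mul_eq_zero.mp (?_ : (g1 * f2 - g2 * f1) * β = 0)).resolve_left hD
    linear_combination g1 * h2 - g2 * h1

theorem aux_par {q r d q' r' d' : ℂ} (e1 : q * q = r * r) (e2 : q * d = r * d)
    (k1 : q * q' = r * r') (k2 : q * d' = r' * d) (k3 : r * d' = q' * d) :
    q * r' = q' * r ∧ q * d' = q' * d ∧ r * d' = r' * d := by
  by_cases hd : d = 0
  · subst hd
    by_cases hq : q = 0
    · subst hq
      have hr : r = 0 := by simpa using e1.symm
      subst hr
      simp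
    · have hd' : d' = 0 := by simpa [hq] using k2
      subst hd'
      refine ⟨?_, by simp, by simp⟩
      apply mul_left_cancel₀ hq
      linear_combination r' * e1 - r * k1
  · have hqr : q = r := mul_right_cancel₀ hd e2
    subst hqr
    have : q' = r' := mul_right_cancel₀ hd (by rw [← k3, k2])
    subst this
    exact ⟨by ring, k3, k3⟩

theorem aux_dep {S : Type*} [Semigroup S] (σ : S → S)
    (hσmul : ∀ x y : S, σ (x * y) = σ x * σ y) (hσinv : ∀ x : S, σ (σ x) = x)
    (g : S → ℂ) (l : ℂ) (h : ∀ x y : S, g (x * y) = l * (g x * g (σ y))) :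
    (∀ x y : S, g (x * y) = g (y * x)) ∧ (∀ x y z : S, g (x * y * z) = g (x * z * y)) := by
  by_cases hl : l = 0
  · subst hl
    simp [h]
  by_cases hg : ∀ x, g x = 0
  · simp [hg]
  push Not at hg
  obtain ⟨a, ha⟩ := hg
  have hs : ∀ z, g (σ z) = g z := by
    intro z
    have h1 := h a (σ a * z)
    rw [← mul_assoc, h, h, hσmul, h, hσinv, hσinv] at h1
    have : l * l * g a * g a * g (σ z) = l * l * g a * g a * g z := by
      linear_combination h1
    exact mul_left_cancel₀ (by simp [hl, ha]) this
  constructor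
  · intro x y; rw [h, h, hs, hs]; ring
  · intro x y z; rw [h, h, h, h, hs, hs]; ring

theorem aux_ind {S : Type*} [Semigroup S] (σ : S → S)
    (hσmul : ∀ x y : S, σ (x * y) = σ x * σ y) (hσinv : ∀ x : S, σ (σ x) = x)
    (f g : S → ℂ)
    (h : ∀ x y : S, g (x * y) = g x * g (σ y) + f x * f (σ y))
    (a b : S) (hD : g a * f b - g b * f a ≠ 0) :
    (∀ x y : S, f (x * y) = f (y * x)) ∧
    (∀ x y : S, g (x * y) = g (y * x)) ∧
    (∀ x y z : S, f (x * y * z) = f (x * z * y)) ∧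
    (∀ x y z : S, g (x * y * z) = g (x * z * y)) := by
  have hA : ∀ y : S, ∃ p q r s : ℂ, ∀ z, g (y * z) = p * g z + q * f z ∧
      f (y * z) = r * g z + s * f z := by
    intro y
    set D := g a * f b - g b * f a with hDdef
    refine ⟨(f b * g (a * σ y) - f a * g (b * σ y)) / D,
      (f b * f (a * σ y) - f a * f (b * σ y)) / D,
      (g a * g (b * σ y) - g b * g (a * σ y)) / D,
      (g a * f (b * σ y) - g b * f (a * σ y)) / D, fun z => ?_⟩
    have e : ∀ x, g (x * σ y) * g z + f (x * σ y) * f z = g x * g (y * z) + f x * f (y * z) := by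
      intro x
      have h1 := h (x * σ y) (σ z)
      rw [mul_assoc, h, hσmul, hσinv, hσinv] at h1
      exact h1.symm
    have ea := e a
    have eb := e b
    constructor
    · field_simp
      rw [hDdef]
      linear_combination f a * eb - f b * ea
    · field_simp
      rw [hDdef]
      linear_combination g b * ea - g a * eb
  choose p q r s hA using hA
  have hJ : ∀ x y : S, g (x * y) = p (σ y) * g x + r (σ y) * f x ∧
      f (x * y) = q (σ y) * g x + s (σ y) * f x := by
    intro x y
    have e : ∀ z, (g (x * y) - (p (σ y) * g x + r (σ y) * f x)) * g z +
        (f (x * y) - (q (σ y) * g x + s (σ y) * f x)) * f z = 0 := by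
      intro z
      have h1 := h (x * y) (σ z)
      rw [mul_assoc, h, hσmul, hσinv, (hA _ _).1, (hA _ _).2] at h1
      linear_combination -h1
    have := aux_cancel hD (e a) (e b)
    exact ⟨sub_eq_zero.mp this.1, sub_eq_zero.mp this.2⟩
  have hC : ∀ x z : S, q x * q z = r x * r z ∧ q x * (p z - s z) = r z * (p x - s x) ∧
      r x * (p z - s z) = q z * (p x - s x) := by
    intro x z
    have e : ∀ y, (q x * q z - r x * r z) * g y +
          (p x * r z + q x * s z - p z * q x - r z * s x) * f y = 0 ∧
        (r x * p z + s x * q z - q z * p x - s z * r x) * g y +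
          (r x * r z - q x * q z) * f y = 0 := by
      intro y
      have h1 := (hJ (x * y) (σ z)).1
      have h2 := (hJ (x * y) (σ z)).2
      rw [mul_assoc, (hA _ _).1, (hA x y).1, (hA x y).2, (hJ _ _).1, (hJ _ _).2, hσinv] at h1
      rw [mul_assoc, (hA _ _).2, (hA x y).1, (hA x y).2, (hJ _ _).1, (hJ _ _).2, hσinv] at h2
      exact ⟨by linear_combination h1, by linear_combination h2⟩
    have c1 := aux_cancel hD (e a).1 (e b).1
    have c2 := aux_cancel hD (e a).2 (e b).2
    exact ⟨by linear_combination c1.1, by linear_combination -c1.2, by linear_combination c2.1⟩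
  have hP : ∀ x y : S, q x * r y = q y * r x ∧ q x * (p y - s y) = q y * (p x - s x) ∧
      r x * (p y - s y) = r y * (p x - s x) := fun x y =>
    aux_par (hC x x).1 (hC x x).2.1 (hC x y).1 (hC x y).2.1 (hC x y).2.2
  have g3 : ∀ x y z : S, g (x * y * z) = g (x * z * y) := by
    intro x y z
    obtain ⟨i1, i2, i3⟩ := hP (σ y) (σ z)
    rw [(hJ _ z).1, (hJ _ y).1, (hJ _ y).1, (hJ _ y).2, (hJ _ z).1, (hJ _ z).2]
    linear_combination g x * i1 + f x * i3
  have f3 : ∀ x y z : S, f (x * y * z) = f (x * z * y) := by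
    intro x y z
    obtain ⟨i1, i2, i3⟩ := hP (σ y) (σ z)
    rw [(hJ _ z).2, (hJ _ y).2, (hJ _ y).1, (hJ _ y).2, (hJ _ z).1, (hJ _ z).2]
    linear_combination -g x * i2 - f x * i1
  have cen : ∀ y z : S, g (y * z) = g (z * y) ∧ f (y * z) = f (z * y) := by
    intro y z
    have e : ∀ x, (g (y * z) - g (z * y)) * g x + (f (y * z) - f (z * y)) * f x = 0 := by
      intro x
      have h1 := g3 x (σ y) (σ z)
      rw [mul_assoc, mul_assoc, h, h, hσmul, hσmul, hσinv, hσinv] at h1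
      linear_combination h1
    have := aux_cancel hD (e a) (e b)
    exact ⟨sub_eq_zero.mp this.1, sub_eq_zero.mp this.2⟩
  exact ⟨fun x y => (cen x y).2, fun x y => (cen x y).1, f3, g3⟩

/-- any solution of `g(xσ(y)) = g(x)g(y) + f(x)f(y)` consists of
abelian functions `f` and `g`. -/
theorem stmt_3 {S : Type*} [Semigroup S] (σ : S → S)
    (hσmul : ∀ x y : S, σ (x * y) = σ x * σ y) (hσinv : ∀ x : S, σ (σ x) = x)
    (f g : S → ℂ)
    (h : ∀ x y : S, g (x * σ y) = g x * g y + f x * f y) :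
    (∀ x y : S, f (x * y) = f (y * x)) ∧
    (∀ x y : S, g (x * y) = g (y * x)) ∧
    (∀ x y z : S, f (x * y * z) = f (x * z * y)) ∧
    (∀ x y z : S, g (x * y * z) = g (x * z * y)) := by
  have h' : ∀ x y : S, g (x * y) = g x * g (σ y) + f x * f (σ y) := by
    intro x y
    rw [← h, hσinv]
  by_cases hD : ∃ a b, g a * f b - g b * f a ≠ 0
  · obtain ⟨a, b, hD⟩ := hD
    exact aux_ind σ hσmul hσinv f g h' a b hD
  push Not at hD
  by_cases hg : ∀ x, g x = 0
  · have hf : ∀ x, f x = 0 := by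
      intro x
      have := h x x
      simpa [hg] using this
    simp [hf, hg]
  push Not at hg
  obtain ⟨a, ha⟩ := hg
  have hf : ∀ x, f x = f a / g a * g x := by
    intro x
    field_simp
    linear_combination hD a x
  obtain ⟨c1, c2⟩ := aux_dep σ hσmul hσinv g (1 + (f a / g a) ^ 2) (by
    intro x y
    rw [h', hf x, hf (σ y)]
    ring)
  refine ⟨fun x y => ?_, c1, fun x y z => ?_, c2⟩
  · rw [hf, hf (y * x), c1]
  · rw [hf, hf (x * z * y), c2]
end

section
/- Let S be a semigroup and σ:S→S an involutive automorphism. If f,g:S→ℂ are linearly independent functions satisfying g(xσ(y)) = g(x)g(y) + f(x)f(y) for all x,y∈S, then g∘σ = g and either f∘σ = f or f∘σ = −f. -/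
theorem stmt_4 {S : Type*} [Semigroup S] (σ : S → S)
    (hσmul : ∀ x y : S, σ (x * y) = σ x * σ y) (hσinv : ∀ x : S, σ (σ x) = x)
    (f g : S → ℂ) (hind : LinearIndependent ℂ ![f, g])
    (h : ∀ x y : S, g (x * σ y) = g x * g y + f x * f y) :
    (∀ x : S, g (σ x) = g x) ∧
    ((∀ x : S, f (σ x) = f x) ∨ (∀ x : S, f (σ x) = -f x)) := by
  have LI : ∀ a b : ℂ, (∀ x, a * g x + b * f x = 0) → a = 0 ∧ b = 0 := by
    intro a b hab
    have := LinearIndependent.pair_iff.1 hind b a (by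
      funext x
      have := hab x
      simp only [Pi.add_apply, Pi.smul_apply, smul_eq_mul, Pi.zero_apply]
      linear_combination this)
    exact ⟨this.2, this.1⟩
  have LIs : ∀ a b : ℂ, (∀ x, a * g (σ x) + b * f (σ x) = 0) → a = 0 ∧ b = 0 := by
    intro a b hab
    refine LI a b fun x => ?_
    have := hab (σ x)
    rwa [hσinv] at this
  have hm : ∀ x y, g (x * y) = g x * g (σ y) + f x * f (σ y) := by
    intro x y
    have := h x (σ y)
    rwa [hσinv] at this
  have hms : ∀ x y, g (σ (x * y)) = g (σ x) * g y + f (σ x) * f y := by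
    intro x y
    rw [hσmul, h]
  have hsw : ∀ x y, g (σ (y * x)) = g (x * y) := by
    intro x y
    rw [hm, hms]; ring
  have h3 : ∀ x y z, g (σ (x * y * z)) = g (x * y * z) := by
    intro x y z
    rw [hsw z (x * y), ← mul_assoc, ← hsw (z * x) y, ← mul_assoc,
      hsw x (y * z), ← mul_assoc]
  -- nondegeneracy on products
  have K : ∀ a b : ℂ, (∀ x y, a * g (x * y) + b * f (x * y) = 0) → a = 0 ∧ b = 0 := by
    intro a b hab
    by_cases hb : b = 0
    · subst hb
      refine ⟨?_, rfl⟩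
      by_contra ha
      have hg : ∀ x y, g (x * y) = 0 := by
        intro x y
        have := hab x y
        simpa [ha] using this
      have hgz : ∀ y, g (σ y) = 0 := by
        intro y
        refine (LI (g (σ y)) (f (σ y)) fun x => ?_).1
        have := hm x y
        rw [hg] at this
        linear_combination -this
      have := (LIs 1 0 fun x => by rw [hgz]; ring).1
      exact one_ne_zero this
    · exfalso
      obtain ⟨α, hα⟩ : ∃ α : ℂ, ∀ x y, f (x * y) = α * g (x * y) := by
        refine ⟨-a / b, fun x y => ?_⟩
        have := hab x y
        field_simp
        linear_combination this
      have hαs : ∀ x y, f (σ (x * y)) = α * g (σ (x * y)) := by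
        intro x y
        rw [hσmul, hα]
      have key : ∀ x y z, g (x * y) * (g (σ z) + α * f (σ z))
          = (g x + α * f x) * g (σ (y * z)) := by
        intro x y z
        have e1 := hm (x * y) z
        have e2 := hm x (y * z)
        rw [hα] at e1
        rw [hαs, ← mul_assoc] at e2
        linear_combination e2 - e1
      obtain ⟨z, hz⟩ : ∃ z, g (σ z) + α * f (σ z) ≠ 0 := by
        by_contra hc
        push Not at hc
        exact one_ne_zero (LIs 1 α fun x => by rw [← hc x]; ring).1
      have hq : ∀ y, f (σ y) = α * g (σ y) := by
        intro y
        set P := g (σ z) + α * f (σ z) with hP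
        have := LI (g (σ y) * P - g (σ (y * z))) (f (σ y) * P - α * g (σ (y * z))) (by
          intro x
          have e := key x y z
          rw [hm x y] at e
          linear_combination e)
        have h0 : (f (σ y) - α * g (σ y)) * P = 0 := by
          linear_combination this.2 - α * this.1
        rcases mul_eq_zero.1 h0 with h1 | h1
        · linear_combination h1
        · exact absurd h1 hz
      exact one_ne_zero (LIs (-α) 1 fun x => by rw [hq x]; ring).2
  obtain ⟨z0, hz0⟩ : ∃ z, f (σ z) ≠ 0 := by
    by_contra hc
    push Not at hc
    exact one_ne_zero (LIs 0 1 fun x => by rw [hc x]; ring).2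
  have hf : ∀ y, ∃ A B : ℂ, ∀ x, f (x * y) = g x * A + f x * B := by
    intro y
    refine ⟨(g (σ (y * z0)) - g (σ y) * g (σ z0)) / f (σ z0),
      (f (σ (y * z0)) - f (σ y) * g (σ z0)) / f (σ z0), fun x => ?_⟩
    have e1 := hm (x * y) z0
    have e2 := hm x (y * z0)
    rw [hm x y] at e1
    rw [← mul_assoc] at e2
    field_simp
    linear_combination e2 - e1
  have K3 : ∀ a b : ℂ, (∀ x y z, a * g (x * y * z) + b * f (x * y * z) = 0) →
      a = 0 ∧ b = 0 := by
    intro a b hab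
    refine K a b fun x z => ?_
    obtain ⟨A, B, hAB⟩ := hf z
    have := K (a * g (σ z) + b * A) (a * f (σ z) + b * B) (by
      intro x y
      have e := hab x y z
      rw [hm, hAB] at e
      linear_combination e)
    rw [hm, hAB]
    linear_combination g x * this.1 + f x * this.2
  have rel : ∀ x y z, g (y * z) * g (σ x) + f (y * z) * f (σ x)
      = g (σ (y * z)) * g x + f (σ (y * z)) * f x := by
    intro x y z
    have e1 := hm x (y * z)
    have e2 := hms x (y * z)
    rw [← mul_assoc] at e1 e2
    rw [h3] at e2
    linear_combination e1 - e2
  obtain ⟨p, q, hpq⟩ : ∃ p q, g (p * q) ≠ 0 := by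
    by_contra hc
    push Not at hc
    exact one_ne_zero (K 1 0 fun x y => by rw [hc x y]; ring).1
  obtain ⟨r, s, hrs⟩ : ∃ r s, - f (p * q) * g (r * s) + g (p * q) * f (r * s) ≠ 0 := by
    by_contra hc
    push Not at hc
    exact hpq (K _ _ hc).2
  obtain ⟨α, β, hαβ⟩ : ∃ α β : ℂ, ∀ x, g (σ x) = α * g x + β * f x := by
    set D := - f (p * q) * g (r * s) + g (p * q) * f (r * s) with hD
    refine ⟨(f (r * s) * g (σ (p * q)) - f (p * q) * g (σ (r * s))) / D,
      (f (r * s) * f (σ (p * q)) - f (p * q) * f (σ (r * s))) / D, fun x => ?_⟩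
    have e1 := rel x p q
    have e2 := rel x r s
    field_simp
    linear_combination f (r * s) * e1 - f (p * q) * e2 + g (σ x) * hD
  have hfin := K3 (α - 1) β (by
    intro x y z
    have e := hαβ (x * y * z)
    rw [h3] at e
    linear_combination -e)
  have hg : ∀ x, g (σ x) = g x := by
    intro x
    rw [hαβ]
    linear_combination g x * hfin.1 + f x * hfin.2
  refine ⟨hg, ?_⟩
  have hff : ∀ x y, f (σ x) * f (σ y) = f x * f y := by
    intro x y
    have e1 := h x y
    have e2 := hm (σ x) y
    have e3 := hg (x * σ y)
    rw [hσmul, hσinv] at e3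
    rw [hg, hg] at e2
    linear_combination e1 - e2 + e3
  have hz1 := hff z0 z0
  rcases mul_self_eq_mul_self_iff.1 hz1 with e | e
  · left
    intro x
    apply mul_right_cancel₀ hz0
    rw [hff, e]
  · right
    intro x
    apply mul_right_cancel₀ hz0
    rw [hff, e]; ring
end

section
/- Let S be a semigroup and σ:S→S an involutive automorphism. If f,g:S→ℂ are linearly independent functions satisfying f(xσ(y)) = f(x)g(y) + f(y)g(x) for all x,y∈S, then f∘σ = f and g∘σ = g. -/
/-- if `f, g` are linearly independent solutions of the sine addition
formula `f(xσ(y)) = f(x)g(y) + f(y)g(x)`, then `f ∘ σ = f` and `g ∘ σ = g`. -/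
theorem stmt_6 {S : Type*} [Semigroup S] (σ : S → S)
    (hσmul : ∀ x y : S, σ (x * y) = σ x * σ y) (hσinv : ∀ x : S, σ (σ x) = x)
    (f g : S → ℂ) (hind : LinearIndependent ℂ ![f, g])
    (h : ∀ x y : S, f (x * σ y) = f x * g y + f y * g x) :
    (∀ x : S, f (σ x) = f x) ∧ (∀ x : S, g (σ x) = g x) := by
  have hI : ∀ a b : ℂ, (∀ x, a * f x + b * g x = 0) → a = 0 ∧ b = 0 := by
    intro a b hab
    refine LinearIndependent.pair_iff.1 hind a b ?_
    funext x
    simpa using hab x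
  have h1 : ∀ x y, f (x * y) = f x * g (σ y) + f (σ y) * g x := by
    intro x y
    have := h x (σ y)
    rwa [hσinv] at this
  have h2 : ∀ x y, f (σ (x * y)) = f (σ x) * g y + f y * g (σ x) := by
    intro x y
    rw [hσmul, h]
  have hsw : ∀ x y, f (x * y) = f (σ (y * x)) := by
    intro x y
    rw [h1, h2]; ring
  have h3 : ∀ x y z, f (x * (y * z)) = f (σ (x * (y * z))) := by
    intro x y z
    rw [hsw x (y * z), mul_assoc, ← hsw (z * x) y, mul_assoc, hsw z (x * y), mul_assoc]
  obtain ⟨w, hw⟩ : ∃ w, f w ≠ 0 := by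
    by_contra hc
    push Not at hc
    have := (hI 1 0 (by intro x; simp [hc x])).1
    exact one_ne_zero this
  obtain ⟨A, B, hg⟩ : ∃ A B : S → ℂ, ∀ x y, g (x * y) = f x * A y + g x * B y := by
    refine ⟨fun y => (g (σ (y * σ w)) - g w * g (σ y)) / f w,
      fun y => (f (σ (y * σ w)) - g w * f (σ y)) / f w, ?_⟩
    intro x y
    have e1 := h1 (x * y) (σ w)
    have e2 := h1 x (y * σ w)
    rw [mul_assoc, e2, h1 x y, hσinv] at e1
    field_simp
    linear_combination -e1
  have hB : ∀ y z, f (σ (y * z)) = f (σ y) * g (σ z) + f (σ z) * B y := by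
    intro y z
    have := (hI (g (σ y) * g (σ z) + f (σ z) * A y - g (σ (y * z)))
      (f (σ y) * g (σ z) + f (σ z) * B y - f (σ (y * z))) (by
        intro x
        have e1 := h1 (x * y) z
        have e2 := h1 x (y * z)
        rw [mul_assoc, e2, h1 x y, hg] at e1
        linear_combination -e1)).2
    linear_combination -this
  have hk : ∀ y z, f (σ y) * (g (σ z) - g z) = f z * g (σ y) - f (σ z) * B y := by
    intro y z
    linear_combination h2 y z - hB y z
  obtain ⟨α, β, hαβ⟩ : ∃ α β : ℂ, ∀ z, g (σ z) - g z = α * f z - β * f (σ z) := by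
    refine ⟨g w / f w, B (σ w) / f w, fun z => ?_⟩
    have := hk (σ w) z
    rw [hσinv] at this
    field_simp
    linear_combination this
  obtain ⟨y, hy⟩ : ∃ y, α * f (σ y) - g (σ y) ≠ 0 := by
    by_contra hc
    push Not at hc
    have := (hI α (-1) (by
      intro x
      have := hc (σ x)
      rw [hσinv] at this
      linear_combination this)).2
    norm_num at this
  obtain ⟨l, hl⟩ : ∃ l : ℂ, ∀ z, f z = l * f (σ z) := by
    refine ⟨(β * f (σ y) - B y) / (α * f (σ y) - g (σ y)), fun z => ?_⟩
    have := hk y z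
    rw [hαβ] at this
    rw [div_mul_eq_mul_div, eq_div_iff hy]
    linear_combination this
  have hl2 : (l - 1) * (l + 1) = 0 := by
    have e1 := hl w
    have e2 := hl (σ w)
    rw [hσinv] at e2
    apply mul_right_cancel₀ hw
    linear_combination -e1 - l * e2
  obtain ⟨γ, hγ⟩ : ∃ γ : ℂ, ∀ z, g (σ z) - g z = γ * f (σ z) :=
    ⟨α * l - β, fun z => by rw [hαβ, hl z]; ring⟩
  rcases mul_eq_zero.1 hl2 with hl1 | hl1
  · have l1 : l = 1 := by linear_combination hl1
    subst l1
    have hf : ∀ x, f (σ x) = f x := fun x => by rw [hl x]; ring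
    refine ⟨hf, fun x => ?_⟩
    have e1 := hγ x
    have e2 := hγ (σ x)
    rw [hσinv] at e2
    rw [hf] at e1
    linear_combination (e1 - e2) / 2
  · exfalso
    have l1 : l = -1 := by linear_combination hl1
    subst l1
    have hf : ∀ x, f (σ x) = - f x := fun x => by rw [hl x]; ring
    have hγ0 : γ = 0 := by
      have e := hsw w w
      rw [h1, h2, hf] at e
      have e3 := hsw w w
      rw [hf] at e3
      have e4 := h1 w w
      have e1 := hγ w
      rw [hf] at e1 e4
      have : γ * (f w * f w) = 0 := by
        linear_combination f w * e1 + e4 - e3 / 2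
      rcases mul_eq_zero.1 this with h0 | h0
      · exact h0
      · exact absurd h0 (mul_ne_zero hw hw)
    have hgs : ∀ x, g (σ x) = g x := fun x => by
      have := hγ x
      rw [hγ0] at this
      linear_combination this
    have h0 : ∀ y z, f (y * z) = 0 := by
      intro y z
      have := (hI (g (y * z)) (- f (y * z)) (by
        intro x
        have e1 := h3 x y z
        have e2 := h1 x (y * z)
        rw [hf] at e1 e2
        rw [hgs] at e2
        linear_combination e1 / 2 - e2)).2
      linear_combination -this
    have := (hI (g w) (- f w) (by
      intro x
      have e := h1 x w
      rw [h0, hf, hgs] at e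
      linear_combination -e)).2
    exact hw (by linear_combination -this)
end

section
/- Let S be a semigroup and σ:S→S an involutive automorphism. If f,g:S→ℂ satisfy f(xσ(y)) = f(x)g(y) + f(y)g(x) for all x,y∈S and f ≠ 0, then both f and g are abelian; that is, f(xy)=f(yx), g(xy)=g(yx), f(xyz)=f(xzy), and g(xyz)=g(xzy) for all x,y,z∈S. -/
/-- if `f ≠ 0` and `f(xσ(y)) = f(x)g(y) + f(y)g(x)` for all `x, y`,
then `f` and `g` are abelian. -/
theorem stmt_7 {S : Type*} [Semigroup S] (σ : S → S)
    (hσmul : ∀ x y : S, σ (x * y) = σ x * σ y) (hσinv : ∀ x : S, σ (σ x) = x)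
    (f g : S → ℂ) (hf : f ≠ 0)
    (h : ∀ x y : S, f (x * σ y) = f x * g y + f y * g x) :
    (∀ x y : S, f (x * y) = f (y * x)) ∧
    (∀ x y : S, g (x * y) = g (y * x)) ∧
    (∀ x y z : S, f (x * y * z) = f (x * z * y)) ∧
    (∀ x y z : S, g (x * y * z) = g (x * z * y)) := by
  obtain ⟨w, hw⟩ := Function.ne_iff.mp hf
  replace hw : f w ≠ 0 := hw
  have h' : ∀ x y, f (x * y) = f x * g (σ y) + f (σ y) * g x := by
    intro x y
    have := h x (σ y)
    rwa [hσinv] at this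
  -- it suffices to have even f, g and an addition law for g
  have fin : ∀ d : ℂ, (∀ x y, f (x * y) = f x * g y + f y * g x) →
      (∀ x y, g (x * y) = g x * g y + d * f x * f y) →
    (∀ x y : S, f (x * y) = f (y * x)) ∧
    (∀ x y : S, g (x * y) = g (y * x)) ∧
    (∀ x y z : S, f (x * y * z) = f (x * z * y)) ∧
    (∀ x y z : S, g (x * y * z) = g (x * z * y)) := by
    intro d h1 h2
    refine ⟨?_, ?_, ?_, ?_⟩ <;> intros <;> simp only [h1, h2] <;> ring
  by_cases hdep : ∃ c : ℂ, ∀ x, g x = c * f x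
  · obtain ⟨c, hc⟩ := hdep
    by_cases hc0 : c = 0
    · have hg : ∀ x, g x = 0 := by intro x; rw [hc, hc0, zero_mul]
      have hff : ∀ x y, f (x * y) = 0 := by intro x y; rw [h', hg, hg]; ring
      simp [hff, hg]
    · have ev : ∀ z, f (σ z) = f z := by
        intro z
        have e := congrArg f (mul_assoc w (σ w) z)
        simp only [h', hc, hσmul, hσinv] at e
        have : (4 * c ^ 2 * f w * f w) * (f (σ z) - f z) = 0 := by linear_combination e
        have h4 : (4 * c ^ 2 * f w * f w) ≠ 0 := by simp [hc0, hw]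
        exact sub_eq_zero.mp ((mul_eq_zero.mp this).resolve_left h4)
      refine fin (c ^ 2) ?_ ?_
      · intro x y; simp only [h', hc, ev]
      · intro x y; simp only [h', hc, ev]; ring
  · have hI : ∀ α β : ℂ, (∀ x, α * f x + β * g x = 0) → α = 0 ∧ β = 0 := by
      intro α β hab
      have hβ : β = 0 := by
        by_contra hβ
        exact hdep ⟨-α / β, fun x => by field_simp; linear_combination hab x⟩
      refine ⟨?_, hβ⟩
      have := hab w
      simpa [hβ, hw] using this
    have hIs : ∀ α β : ℂ, (∀ x, α * f (σ x) + β * g (σ x) = 0) → α = 0 ∧ β = 0 := by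
      intro α β hab
      refine hI α β fun x => ?_
      have := hab (σ x)
      rwa [hσinv] at this
    obtain ⟨p, q, hpq⟩ : ∃ p q : S → ℂ, ∀ x y, g (x * y) = p y * f x + q y * g x := by
      refine ⟨fun y => (g (σ y * w) - g (σ y) * g w) / f w,
        fun y => (f (σ y) * g (σ w) + f (σ w) * g (σ y) - f (σ y) * g w) / f w, ?_⟩
      intro x y
      have e := congrArg f (mul_assoc x y (σ w))
      rw [h' (x * y), h' x (y * σ w), h' x y, hσmul, hσinv, h' (σ y) w] at e
      field_simp
      linear_combination e
    have key : ∀ y z,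
        (p (σ z) * f (σ y) + q (σ z) * g (σ y) - g (σ y) * g (σ z) - p y * f (σ z) = 0) ∧
        (f (σ y) * g z + f z * g (σ y) - f (σ y) * g (σ z) - q y * f (σ z) = 0) := by
      intro y z
      apply hI
      intro x
      have e := congrArg f (mul_assoc x y z)
      rw [h' (x * y), h' x (y * z), h' x y, hσmul, h' (σ y), hσinv, hpq, hpq] at e
      linear_combination -e
    have hws : f (σ (σ w)) ≠ 0 := by rwa [hσinv]
    obtain ⟨a, b, hq⟩ : ∃ a b : ℂ, ∀ y, q y = a * g (σ y) + b * f (σ y) := by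
      refine ⟨f (σ w) / f w, (g (σ w) - g w) / f w, fun y => ?_⟩
      have e := (key y (σ w)).2
      rw [hσinv] at e
      field_simp
      linear_combination -e
    have hab : ∀ z, (g z - g (σ z) - b * f (σ z) = 0) ∧ (f z - a * f (σ z) = 0) := by
      intro z
      apply hIs
      intro y
      have e := (key y z).2
      rw [hq] at e
      linear_combination e
    obtain ⟨c, d, hp⟩ : ∃ c d : ℂ, ∀ y, p y = c * g (σ y) + d * f (σ y) := by
      refine ⟨(q w - g w) / f w, p w / f w, fun y => ?_⟩
      have e := (key y (σ w)).1
      rw [hσinv] at e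
      field_simp
      linear_combination -e
    have hcd : ∀ z, (p (σ z) - d * f (σ z) = 0) ∧ (q (σ z) - g (σ z) - c * f (σ z) = 0) := by
      intro z
      apply hIs
      intro y
      have e := (key y z).1
      rw [hp y] at e
      linear_combination e
    have hp2 : ∀ z, p z = d * f z := by
      intro z
      have := (hcd (σ z)).1
      rw [hσinv] at this
      linear_combination this
    have hq2 : ∀ z, q z = g z + c * f z := by
      intro z
      have := (hcd (σ z)).2
      rw [hσinv] at this
      linear_combination this
    have ha : (a - 1) * (a + 1) = 0 := by
      have e1 := (hab w).2
      have e2 := (hab (σ w)).2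
      rw [hσinv] at e2
      have : (a - 1) * (a + 1) * f w = 0 := by linear_combination -e1 - a * e2
      exact (mul_eq_zero.mp this).resolve_right hw
    rcases mul_eq_zero.mp ha with ha | ha
    · have ha : a = 1 := by linear_combination ha
      subst ha
      have fe : ∀ z, f (σ z) = f z := fun z => by linear_combination -(hab z).2
      have hb : b = 0 := by
        have e1 := (hab w).1
        have e2 := (hab (σ w)).1
        rw [hσinv] at e2
        rw [fe] at e1
        have : b * f w = 0 := by linear_combination -(e1 + e2) / 2
        exact (mul_eq_zero.mp this).resolve_right hw
      subst hb
      have ge : ∀ z, g (σ z) = g z := fun z => by linear_combination -(hab z).1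
      have hq3 : ∀ z, q z = g z := fun z => by rw [hq, ge]; ring
      refine fin d ?_ ?_
      · intro x y; rw [h', fe, ge]
      · intro x y; rw [hpq, hp2, hq3]; ring
    · exfalso
      have ha : a = -1 := by linear_combination ha
      subst ha
      have := (hI (2 * b + c) 2 (fun z => by
        have e1 := (hab z).1
        have e2 := (hab z).2
        have e3 := hq z
        rw [hq2] at e3
        linear_combination e3 + e1 + 2 * b * e2)).2
      norm_num at this
end

section
/- Let S be a semigroup and σ:S→S an involutive automorphism. If f,g:S→ℂ satisfy f(xσ(y)) = f(x)g(y) + f(y)g(x) − g(x)g(y) for all x,y∈S, then f(xy) = f(σ(y)σ(x)) for all x,y∈S, and f(xyz) = f(σ(x)σ(y)σ(z)) for all x,y,z∈S. -/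
/-- if `f(xσ(y)) = f(x)g(y) + f(y)g(x) − g(x)g(y)`, then
`f(xy) = f(σ(y)σ(x))` and `f(xyz) = f(σ(x)σ(y)σ(z))`. -/
theorem stmt_8 {S : Type*} [Semigroup S] (σ : S → S)
    (hσmul : ∀ x y : S, σ (x * y) = σ x * σ y) (hσinv : ∀ x : S, σ (σ x) = x)
    (f g : S → ℂ)
    (h : ∀ x y : S, f (x * σ y) = f x * g y + f y * g x - g x * g y) :
    (∀ x y : S, f (x * y) = f (σ y * σ x)) ∧
    (∀ x y z : S, f (x * y * z) = f (σ x * σ y * σ z)) := by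
  have h1 : ∀ x y : S, f (x * y) = f (σ y * σ x) := by
    intro x y
    have e1 := h x (σ y)
    rw [hσinv] at e1
    rw [e1, h (σ y) x]
    ring
  refine ⟨h1, fun x y z => ?_⟩
  have a := h1 (x * y) z
  have b := h1 (y * z) x
  have c := h1 y (z * x)
  rw [hσmul] at a b c
  simp only [mul_assoc] at a b c ⊢
  rw [a, ← b, c]
end

section
/- Let S be a semigroup and σ:S→S an involutive automorphism. If f,g:S→ℂ satisfy f(xσ(y)) = f(x)g(y) + f(y)g(x) − g(x)g(y) for all x,y∈S, then for all x,y,z∈S: (f(x)−g(x))(g(yz)−g(y)g(z)) = (f(z)−g(z)) g(xσ(y)) + g(x)(f(y)g(z) − f(yz)). -/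
/-- the basic identity satisfied by solutions of
`f(xσ(y)) = f(x)g(y) + f(y)g(x) − g(x)g(y)`. -/
theorem stmt_9 {S : Type*} [Semigroup S] (σ : S → S)
    (hσmul : ∀ x y : S, σ (x * y) = σ x * σ y) (hσinv : ∀ x : S, σ (σ x) = x)
    (f g : S → ℂ)
    (h : ∀ x y : S, f (x * σ y) = f x * g y + f y * g x - g x * g y) :
    ∀ x y z : S,
      (f x - g x) * (g (y * z) - g y * g z) =
        (f z - g z) * g (x * σ y) + g x * (f y * g z - f (y * z)) := by
  intro x y z
  have h1 := h x (y * z)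
  have h2 := h (x * σ y) z
  have h3 := h x y
  rw [hσmul, ← mul_assoc, h2, h3] at h1
  linear_combination -h1
end

section
/- Let S be a semigroup and σ:S→S an involutive automorphism. If f,g:S→ℂ are linearly independent functions satisfying f(xσ(y)) = f(x)g(y) + f(y)g(x) − g(x)g(y) for all x,y∈S, then there exist functions h,k:S→ℂ such that g(xσ(y)) = f(x)h(y) + g(x)k(y) for all x,y∈S. -/
/-- for linearly independent solutions of
`f(xσ(y)) = f(x)g(y) + f(y)g(x) − g(x)g(y)` there are `h, k` with
`g(xσ(y)) = f(x)h(y) + g(x)k(y)`. -/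
theorem stmt_10 {S : Type*} [Semigroup S] (σ : S → S)
    (hσmul : ∀ x y : S, σ (x * y) = σ x * σ y) (hσinv : ∀ x : S, σ (σ x) = x)
    (f g : S → ℂ) (hind : LinearIndependent ℂ ![f, g])
    (h : ∀ x y : S, f (x * σ y) = f x * g y + f y * g x - g x * g y) :
    ∃ h k : S → ℂ, ∀ x y : S, g (x * σ y) = f x * h y + g x * k y := by
  have hne : ∃ z, f z - g z ≠ 0 := by
    by_contra hc
    push Not at hc
    have hfg : f = g := funext fun z => sub_eq_zero.mp (hc z)
    have h01 : (0 : Fin 2) = 1 := hind.injective (by simpa using hfg)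
    exact absurd h01 (by decide)
  obtain ⟨z, hz⟩ := hne
  refine ⟨fun y => (g (y * z) - g z * g y) / (f z - g z),
    fun y => (f (y * z) - g (y * z) - g z * (f y - g y)) / (f z - g z), fun x y => ?_⟩
  have h1 := h x (y * z)
  rw [hσmul, ← mul_assoc, h (x * σ y) z, h x y] at h1
  field_simp
  linear_combination h1
end

section
/- Let S be a semigroup and σ:S→S an involutive automorphism. Suppose f,g:S→ℂ are linearly independent functions satisfying f(xσ(y)) = f(x)g(y) + f(y)g(x) − g(x)g(y) for all x,y∈S. Then there exist constants α,β∈ℂ such that g = (1−β)(g∘σ) + β(f∘σ) and α((f∘σ)−(g∘σ)) = f−g; moreover α ∈ {−1,1}, and if α = 1 then β = 0, g∘σ = g, and f∘σ = f. -/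
/-- structure constants `α, β` for linearly independent solutions of
`f(xσ(y)) = f(x)g(y) + f(y)g(x) − g(x)g(y)`. -/
theorem stmt_11 {S : Type*} [Semigroup S] (σ : S → S)
    (hσmul : ∀ x y : S, σ (x * y) = σ x * σ y) (hσinv : ∀ x : S, σ (σ x) = x)
    (f g : S → ℂ) (hind : LinearIndependent ℂ ![f, g])
    (h : ∀ x y : S, f (x * σ y) = f x * g y + f y * g x - g x * g y) :
    ∃ α β : ℂ,
      (∀ x : S, g x = (1 - β) * g (σ x) + β * f (σ x)) ∧
      (∀ x : S, α * (f (σ x) - g (σ x)) = f x - g x) ∧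
      (α = -1 ∨ α = 1) ∧
      (α = 1 → β = 0 ∧ (∀ x : S, g (σ x) = g x) ∧ (∀ x : S, f (σ x) = f x)) := by
  have ind : ∀ a b : ℂ, (∀ x, a * f x + b * g x = 0) → a = 0 ∧ b = 0 := by
    intro a b hab
    refine LinearIndependent.pair_iff.mp hind a b ?_
    funext x
    simpa using hab x
  have hf : ∀ x y, f (x * y) = f x * g (σ y) + f (σ y) * g x - g x * g (σ y) := by
    intro x y
    have := h x (σ y)
    rwa [hσinv] at this
  have hF : ∀ x y, f (σ (x * y)) = f (y * x) := by
    intro x y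
    rw [hσmul, h, hf]
    ring
  obtain ⟨w, hw⟩ : ∃ w, f (σ w) - g (σ w) ≠ 0 := by
    by_contra hc
    push Not at hc
    have := (ind 1 (-1) (fun x => by
      have := hc (σ x)
      rw [hσinv] at this
      linear_combination this)).1
    exact one_ne_zero this
  have key : ∀ x y z, f (x * y) * g (σ z) + g (x * y) * (f (σ z) - g (σ z))
      = (f x - g x) * g (σ (y * z)) + g x * f (z * y) := by
    intro x y z
    have h1 := hf (x * y) z
    have h2 := hf x (y * z)
    rw [hF, ← mul_assoc] at h2
    linear_combination h2 - h1
  obtain ⟨a, ha⟩ : ∃ a, a * (f (σ w) - g (σ w)) = g w - g (σ w) := ⟨_, div_mul_cancel₀ _ hw⟩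
  obtain ⟨b, hb⟩ : ∃ b, b * (f (σ w) - g (σ w)) = f w - g w := ⟨_, div_mul_cancel₀ _ hw⟩
  have key2 : ∀ y z, f (σ y) * (g z - g (σ z) - a * (f (σ z) - g (σ z)))
      + g (σ y) * (f z - g z - b * (f (σ z) - g (σ z))) = 0 := by
    intro y z
    set P := g (σ y) * g (σ z) * (f (σ w) - g (σ w))
      + (g (σ (y * w)) - g (σ y) * g (σ w)) * (f (σ z) - g (σ z))
      - g (σ (y * z)) * (f (σ w) - g (σ w)) with hP
    set Q := (f (σ y) * (g z - g (σ z) - a * (f (σ z) - g (σ z)))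
      + g (σ y) * (f z - g z - b * (f (σ z) - g (σ z)))) * (f (σ w) - g (σ w)) with hQ
    have hQ0 := (ind P (-P - Q) (fun x => by
      have e1 := key x y z
      have e2 := key x y w
      rw [hf x y, hf z y] at e1
      rw [hf x y, hf w y] at e2
      rw [hP, hQ]
      linear_combination (f (σ w) - g (σ w)) * e1 - (f (σ z) - g (σ z)) * e2
        + g x * (f (σ z) - g (σ z)) * (f (σ y) * ha + g (σ y) * hb)))
    have : Q = 0 := by linear_combination -hQ0.1 - hQ0.2
    exact (mul_eq_zero.mp this).resolve_right hw
  have key3 : ∀ z, g z - g (σ z) - a * (f (σ z) - g (σ z)) = 0 ∧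
      f z - g z - b * (f (σ z) - g (σ z)) = 0 := by
    intro z
    refine ind _ _ (fun x => ?_)
    have := key2 (σ x) z
    rw [hσinv] at this
    linear_combination this
  have k1 := (key3 w).2
  have k2 := (key3 (σ w)).2
  have k3 := (key3 w).1
  have k4 := (key3 (σ w)).1
  rw [hσinv] at k2 k4
  refine ⟨b, a, fun x => by linear_combination (key3 x).1,
    fun x => by linear_combination -(key3 x).2, ?_, ?_⟩
  · have : (b + 1) * (b - 1) = 0 := by
      apply (mul_eq_zero.mp (?_ : _ * (f (σ w) - g (σ w)) = 0)).resolve_right hw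
      linear_combination -k2 - b * k1
    rcases mul_eq_zero.mp this with h1 | h1
    · left; linear_combination h1
    · right; linear_combination h1
  · rintro rfl
    have ha0 : a = 0 := by
      have : 2 * a = 0 := by
        apply (mul_eq_zero.mp (?_ : _ * (f (σ w) - g (σ w)) = 0)).resolve_right hw
        linear_combination -k3 - k4 - a * k1
      simpa using this
    subst ha0
    refine ⟨rfl, fun x => ?_, fun x => ?_⟩
    · linear_combination -(key3 x).1
    · linear_combination -(key3 x).1 - (key3 x).2
end

section
/- Let S be a semigroup and σ:S→S an involutive automorphism. Functions f,g:S→ℂ satisfy f(xσ(y)) = f(x)g(y) + f(y)g(x) − g(x)g(y) for all x,y∈S if and only if one of the following holds: (1) f=0 and g=0; (2) f is a nonzero function vanishing on S² and g=0; (3) f is a nonzero function vanishing on S² and g=2f; (4) f = (β²/(2β−1))χ and g = βχ for some nonzero multiplicative χ:S→ℂ with χ∘σ=χ and some β∈ℂ∖{0,1/2}; (5) f = (χ₁+χ₂)/2 + ((c₁²+1)/(2c₁))·(χ₁−χ₂)/2 and g = (χ₁+χ₂)/2 + c₁(χ₁−χ₂)/2 for two distinct nonzero multiplicative functions χ₁,χ₂:S→ℂ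 with χ₁∘σ=χ₁, χ₂∘σ=χ₂, and some c₁∈ℂ∖{0,−1,1}; (6) f = (1/2)φ + χ and g = φ + χ, where χ:S→ℂ is a nonzero multiplicative function with χ∘σ=χ and φ:S→ℂ is a nonzero function with φ∘σ=φ satisfying φ(xy)=φ(x)χ(y)+φ(y)χ(x) for all x,y∈S; (7) f = φ + χ and g = χ, where χ and φ are as in (6); (8) f = (χ+χ∘σ)/2 and g ∈ {χ, χ∘σ}, where χ:S→ℂ is a nonzero multiplicative function with χ∘σ ≠ χ. -/
/-- solutions of `f(xσ(y)) = f(x)g(y) + f(y)g(x) − g(x)g(y)`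
(Theorem 6.3 of the paper). -/
theorem stmt_12 {S : Type*} [Semigroup S] (σ : S → S)
    (hσmul : ∀ x y : S, σ (x * y) = σ x * σ y) (hσinv : ∀ x : S, σ (σ x) = x)
    (f g : S → ℂ) :
    (∀ x y : S, f (x * σ y) = f x * g y + f y * g x - g x * g y) ↔
    ((f = 0 ∧ g = 0) ∨
     (f ≠ 0 ∧ (∀ x y : S, f (x * y) = 0) ∧ g = 0) ∨
     (f ≠ 0 ∧ (∀ x y : S, f (x * y) = 0) ∧ (∀ x : S, g x = 2 * f x)) ∨
     (∃ (β : ℂ) (χ : S → ℂ), β ≠ 0 ∧ β ≠ 1 / 2 ∧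
       (∀ x y : S, χ (x * y) = χ x * χ y) ∧ χ ≠ 0 ∧ (∀ x : S, χ (σ x) = χ x) ∧
       (∀ x : S, f x = (β ^ 2 / (2 * β - 1)) * χ x) ∧
       (∀ x : S, g x = β * χ x)) ∨
     (∃ (c₁ : ℂ) (χ₁ χ₂ : S → ℂ), c₁ ≠ 0 ∧ c₁ ≠ -1 ∧ c₁ ≠ 1 ∧
       (∀ x y : S, χ₁ (x * y) = χ₁ x * χ₁ y) ∧ (∀ x y : S, χ₂ (x * y) = χ₂ x * χ₂ y) ∧
       χ₁ ≠ 0 ∧ χ₂ ≠ 0 ∧ χ₁ ≠ χ₂ ∧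
       (∀ x : S, χ₁ (σ x) = χ₁ x) ∧ (∀ x : S, χ₂ (σ x) = χ₂ x) ∧
       (∀ x : S, f x = (χ₁ x + χ₂ x) / 2 + ((c₁ ^ 2 + 1) / (2 * c₁)) * ((χ₁ x - χ₂ x) / 2)) ∧
       (∀ x : S, g x = (χ₁ x + χ₂ x) / 2 + c₁ * ((χ₁ x - χ₂ x) / 2))) ∨
     (∃ χ φ : S → ℂ,
       (∀ x y : S, χ (x * y) = χ x * χ y) ∧ χ ≠ 0 ∧ (∀ x : S, χ (σ x) = χ x) ∧
       φ ≠ 0 ∧ (∀ x : S, φ (σ x) = φ x) ∧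
       (∀ x y : S, φ (x * y) = φ x * χ y + φ y * χ x) ∧
       (∀ x : S, f x = (1 / 2) * φ x + χ x) ∧
       (∀ x : S, g x = φ x + χ x)) ∨
     (∃ χ φ : S → ℂ,
       (∀ x y : S, χ (x * y) = χ x * χ y) ∧ χ ≠ 0 ∧ (∀ x : S, χ (σ x) = χ x) ∧
       φ ≠ 0 ∧ (∀ x : S, φ (σ x) = φ x) ∧
       (∀ x y : S, φ (x * y) = φ x * χ y + φ y * χ x) ∧
       (∀ x : S, f x = φ x + χ x) ∧
       (∀ x : S, g x = χ x)) ∨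
     (∃ χ : S → ℂ,
       (∀ x y : S, χ (x * y) = χ x * χ y) ∧ χ ≠ 0 ∧ (fun x => χ (σ x)) ≠ χ ∧
       (∀ x : S, f x = (χ x + χ (σ x)) / 2) ∧
       ((∀ x : S, g x = χ x) ∨ (∀ x : S, g x = χ (σ x))))) := by
  constructor
  · intro E
    by_cases hf : f = 0
    · left
      refine ⟨hf, ?_⟩
      funext x
      have := E x x
      simp only [hf, Pi.zero_apply] at this ⊢
      have h2 : g x * g x = 0 := by linear_combination this
      exact mul_self_eq_zero.mp h2
    by_cases hdep : ∃ γ : ℂ, ∀ x, g x = γ * f x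
    · obtain ⟨γ, hγ⟩ := hdep
      have E1 : ∀ x y, f (x * σ y) = γ * (2 - γ) * (f x * f y) := by
        intro x y
        rw [E, hγ, hγ]; ring
      by_cases h0 : γ = 0
      · right; left
        refine ⟨hf, ?_, ?_⟩
        · intro x y
          have := E1 x (σ y)
          rw [hσinv, h0] at this
          rw [this]; ring
        · funext x
          simp [hγ, h0]
      by_cases h2 : γ = 2
      · right; right; left
        refine ⟨hf, ?_, ?_⟩
        · intro x y
          have := E1 x (σ y)
          rw [hσinv, h2] at this
          rw [this]; ring
        · intro x
          rw [hγ, h2]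
      have h2' : 2 - γ ≠ 0 := sub_ne_zero.mpr (Ne.symm h2)
      have hδ : γ * (2 - γ) ≠ 0 := mul_ne_zero h0 h2'
      obtain ⟨x0, hx0⟩ := Function.ne_iff.mp hf
      simp only [Pi.zero_apply] at hx0
      have E2 : ∀ x y, f (x * y) = γ * (2 - γ) * (f x * f (σ y)) := by
        intro x y
        have := E1 x (σ y)
        rwa [hσinv] at this
      have hs : ∀ z, f (σ z) = f z := by
        have key : ∀ z, γ * (2 - γ) * (γ * (2 - γ)) * f x0 * f (σ x0) * (f (σ z) - f z) = 0 := by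
          intro z
          have a1 := E2 (x0 * x0) z
          rw [E2 x0 x0] at a1
          have a2 := E2 x0 (x0 * z)
          rw [hσmul, E1 (σ x0) z, ← mul_assoc] at a2
          linear_combination a2 - a1
        have key2 : ∀ z, f (σ x0) ≠ 0 → f (σ z) = f z := by
          intro z hz
          have := key z
          have hne : γ * (2 - γ) * (γ * (2 - γ)) * f x0 * f (σ x0) ≠ 0 :=
            mul_ne_zero (mul_ne_zero (mul_ne_zero hδ hδ) hx0) hz
          exact sub_eq_zero.mp ((mul_eq_zero.mp this).resolve_left hne)
        by_cases hz : f (σ x0) = 0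
        · exfalso
          have b1 := E2 (x0 * σ x0) x0
          have b2 := E2 x0 (σ x0 * x0)
          rw [hσmul, hσinv, ← mul_assoc, b1, E1, hz] at b2
          have : γ * (2 - γ) * (γ * (2 - γ)) * f x0 * f x0 * f x0 = 0 := by
            linear_combination -b2
          simp [h0, h2', hx0] at this
        · exact fun z => key2 z hz
      right; right; right; left
      refine ⟨1 / (2 - γ), fun x => γ * (2 - γ) * f x, ?_, ?_, ?_, ?_, ?_, ?_, ?_⟩
      · exact one_div_ne_zero h2'
      · intro hh
        apply h0
        rw [div_eq_div_iff h2' two_ne_zero] at hh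
        linear_combination hh
      · intro x y
        simp only [E2, hs]; ring
      · intro hh
        have := congrFun hh x0
        simp [h0, h2', hx0] at this
      · intro x
        simp only [hs]
      · intro x
        have e : 2 * (1 / (2 - γ)) - 1 = γ / (2 - γ) := by field_simp; ring
        simp only [e]
        field_simp
      · intro x
        simp only [hγ]
        field_simp
    · obtain ⟨h, hh⟩ : ∃ h : S → ℂ, ∀ x, h x = f x - g x := ⟨fun x => f x - g x, fun _ => rfl⟩
      have hg : ∀ x, g x = f x - h x := fun x => by rw [hh]; ring
      have li : ∀ p q : ℂ, (∀ x, p * f x + q * h x = 0) → p = 0 ∧ q = 0 := by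
        intro p q hpq
        have hq : q = 0 := by
          by_contra hq
          apply hdep
          refine ⟨1 + p / q, fun x => ?_⟩
          rw [hg]
          field_simp
          linear_combination -hpq x
        refine ⟨?_, hq⟩
        by_contra hp
        apply hf
        funext x
        have := hpq x
        simpa [hq, hp] using this
      have E1 : ∀ x y, f (x * σ y) = f x * f y - h x * h y := by
        intro x y
        rw [E, hg, hg]; ring
      clear E hh hdep
      have hhne : ∃ z, h z ≠ 0 := by
        by_contra hc
        push Not at hc
        have := (li 0 1 (fun x => by simp [hc])).2
        exact one_ne_zero this
      obtain ⟨z0, hz0⟩ := hhne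
      have E3 : ∀ x y z, h (x * σ y) * h z =
          f x * (f y * f z - f (y * z)) + h x * (h (y * z) - h y * f z) := by
        intro x y z
        have a1 := E1 (x * σ y) z
        have a2 := E1 x (y * z)
        rw [hσmul, ← mul_assoc] at a2
        rw [E1 x y] at a1
        linear_combination a1 - a2
      obtain ⟨A, hA⟩ : ∃ A : S → ℂ, ∀ y, A y = (f y * f z0 - f (y * z0)) / h z0 :=
        ⟨_, fun _ => rfl⟩
      obtain ⟨B, hB⟩ : ∃ B : S → ℂ, ∀ y, B y = (h (y * z0) - h y * f z0) / h z0 :=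
        ⟨_, fun _ => rfl⟩
      have E4 : ∀ x y, h (x * σ y) = f x * A y + h x * B y := by
        intro x y
        have := E3 x y z0
        rw [hA, hB]
        field_simp
        linear_combination this
      have E5 : ∀ y z, f (y * z) = f y * f z - A y * h z ∧ h (y * z) = h y * f z + B y * h z := by
        intro y z
        have := li (A y * h z - (f y * f z - f (y * z))) (B y * h z - (h (y * z) - h y * f z))
          (fun x => by
            have := E3 x y z
            rw [E4] at this
            linear_combination this)
        constructor
        · linear_combination this.1
        · linear_combination -this.2
      clear hA hB
      have E6 : ∀ y z, f y * (f z - f (σ z)) = h y * h z - A y * h (σ z) := by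
        intro y z
        have := (E5 y (σ z)).1
        rw [E1] at this
        linear_combination this
      have E7 : ∀ y z, f y * A z + h y * B z = h y * f (σ z) + B y * h (σ z) := by
        intro y z
        rw [← E4, (E5 y (σ z)).2]
      have hz1 : h (σ (σ z0)) ≠ 0 := by rwa [hσinv]
      obtain ⟨a, b, hab⟩ : ∃ a b : ℂ, ∀ y, A y = a * f y + b * h y := by
        refine ⟨-(f (σ z0) - f (σ (σ z0))) / h (σ (σ z0)), h (σ z0) / h (σ (σ z0)), fun y => ?_⟩
        have := E6 y (σ z0)
        field_simp
        linear_combination this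
      obtain ⟨c, d, hcd⟩ : ∃ c d : ℂ, ∀ y, B y = c * f y + d * h y := by
        refine ⟨A (σ z0) / h (σ (σ z0)), (B (σ z0) - f (σ (σ z0))) / h (σ (σ z0)), fun y => ?_⟩
        have := E7 y (σ z0)
        field_simp
        linear_combination -this
      have F1 : ∀ z, f (σ z) = f z + a * h (σ z) ∧ h z = b * h (σ z) := by
        intro z
        have := li (f z - f (σ z) + a * h (σ z)) (b * h (σ z) - h z) (fun y => by
          have := E6 y z
          rw [hab] at this
          linear_combination this)
        constructor
        · linear_combination -this.1
        · linear_combination -this.2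
      have F2 : ∀ z, A z = c * h (σ z) ∧ B z = f (σ z) + d * h (σ z) := by
        intro z
        have := li (A z - c * h (σ z)) (B z - f (σ z) - d * h (σ z)) (fun y => by
          have := E7 y z
          rw [hcd y] at this
          linear_combination this)
        constructor
        · linear_combination this.1
        · linear_combination this.2
      have hb2 : b * b = 1 := by
        have a1 := (F1 z0).2
        have a2 := (F1 (σ z0)).2
        rw [hσinv] at a2
        have : (b * b - 1) * h z0 = 0 := by linear_combination -a1 - b * a2
        have := (mul_eq_zero.mp this).resolve_right hz0
        linear_combination this
      have hH : ∀ z, h (σ z) = b * h z := by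
        intro z
        linear_combination -b * (F1 z).2 - h (σ z) * hb2
      have h3 := li a (b - c * b) (fun z => by
        have := (F2 z).1
        rw [hab, hH] at this
        linear_combination this)
      have ha : a = 0 := h3.1
      have hc : c = 1 := by linear_combination (-b) * h3.2 - (c - 1) * hb2
      have hF : ∀ z, f (σ z) = f z := fun z => by
        have := (F1 z).1
        rw [ha] at this
        linear_combination this
      have h4 := (li 0 (d - d * b) (fun z => by
        have := (F2 z).2
        rw [hcd, hc, hF, hH] at this
        linear_combination this)).2
      have M1 : ∀ y z, f (y * z) = f y * f z - b * (h y * h z) := by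
        intro y z
        rw [(E5 y z).1, hab, ha]; ring
      have M2 : ∀ y z, h (y * z) = h y * f z + f y * h z + d * (h y * h z) := by
        intro y z
        rw [(E5 y z).2, hcd, hc]; ring
      clear E1 E3 E4 E5 E6 E7 hab hcd F1 F2 h3
      rcases mul_self_eq_one_iff.mp hb2 with hb | hb
      · subst hb
        simp only [one_mul] at M1 hH
        obtain ⟨l, hl⟩ : ∃ l : ℂ, l * l - d * l + 1 = 0 := by
          obtain ⟨s, hs⟩ := IsAlgClosed.exists_pow_nat_eq (d ^ 2 - 4) (n := 2) (by norm_num)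
          exact ⟨(d + s) / 2, by linear_combination hs / 4⟩
        have hl0 : l ≠ 0 := by
          rintro rfl
          simp at hl
        have hd : d = l + l⁻¹ := by
          field_simp
          linear_combination -hl
        have hχ : ∀ x y, f (x * y) + l * h (x * y) = (f x + l * h x) * (f y + l * h y) := by
          intro x y
          rw [M1, M2]
          linear_combination (-h x * h y) * hl
        have hχne : ∀ m : ℂ, (fun x => f x + m * h x) ≠ 0 := by
          intro m hm
          have := (li 1 m (fun x => by simpa using congrFun hm x)).1
          exact one_ne_zero this
        by_cases hl1 : l = 1
        · subst hl1
          right; right; right; right; right; left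
          refine ⟨fun x => f x + 1 * h x, fun x => -2 * h x, hχ, hχne 1, ?_, ?_, ?_, ?_, ?_, ?_⟩
          · intro x; simp only [hF, hH]
          · intro hm
            have := congrFun hm z0
            simp [hz0] at this
          · intro x; simp only [hH]
          · intro x y
            simp only [M2, hd]; ring
          · intro x; ring
          · intro x; simp only [hg]; ring
        by_cases hl2 : l = -1
        · subst hl2
          right; right; right; right; right; right; left
          refine ⟨fun x => f x + (-1) * h x, h, hχ, hχne (-1), ?_, ?_, hH, ?_, ?_, ?_⟩
          · intro x; simp only [hF, hH]
          · intro hm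
            exact hz0 (congrFun hm z0)
          · intro x y
            simp only [M2, hd]; ring
          · intro x; ring
          · intro x; simp only [hg]; ring
        have m1 : l - 1 ≠ 0 := sub_ne_zero.mpr hl1
        have m2 : l + 1 ≠ 0 := fun hm => hl2 (by linear_combination hm)
        right; right; right; right; left
        refine ⟨-(l + 1) / (l - 1), fun x => f x + l * h x, fun x => f x + l⁻¹ * h x,
          ?_, ?_, ?_, hχ, ?_, hχne l, hχne l⁻¹, ?_, ?_, ?_, ?_, ?_⟩
        · exact div_ne_zero (neg_ne_zero.mpr m2) m1
        · intro hm
          rw [div_eq_iff m1] at hm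
          have : (2 : ℂ) = 0 := by linear_combination -hm
          norm_num at this
        · intro hm
          rw [div_eq_iff m1] at hm
          apply hl0
          linear_combination -hm / 2
        · intro x y
          simp only [M1, M2, hd]
          field_simp
          ring
        · intro hm
          have := congrFun hm z0
          have h5 : (l - 1) * (l + 1) * h z0 = 0 := by
            field_simp at this
            linear_combination this
          simp [m1, m2, hz0] at h5
        · intro x; simp only [hF, hH]
        · intro x; simp only [hF, hH]
        · intro x
          field_simp
          ring
        · intro x
          simp only [hg]
          field_simp
          ring
      · subst hb
        have hd : d = 0 := by linear_combination h4 / 2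
        subst hd
        right; right; right; right; right; right; right
        refine ⟨g, ?_, ?_, ?_, ?_, Or.inl fun _ => rfl⟩
        · intro x y
          simp only [hg, M1, M2]; ring
        · intro hm
          have := (li 1 (-1) (fun x => by
            have := congrFun hm x
            rw [hg, Pi.zero_apply] at this
            linear_combination this)).1
          exact one_ne_zero this
        · intro hm
          have := congrFun hm z0
          simp only [hg, hF, hH] at this
          apply hz0
          linear_combination this / 2
        · intro x
          simp only [hg, hF, hH]; ring
  · rintro (⟨rfl, rfl⟩ | ⟨-, h0, rfl⟩ | ⟨-, h0, hg⟩ | ⟨β, χ, h0, h1, hm, -, hs, hf, hg⟩ |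
      ⟨c, χ, ψ, h0, -, -, hm, hn, -, -, -, hs, ht, hf, hg⟩ | ⟨χ, φ, hm, -, hs, -, ht, hp, hf, hg⟩ |
      ⟨χ, φ, hm, -, hs, -, ht, hp, hf, hg⟩ | ⟨χ, hm, -, -, hf, hg⟩) x y
    · simp
    · simp [h0]
    · simp only [h0, hg]; ring
    · have h2 : 2 * β - 1 ≠ 0 := fun h => h1 (by linear_combination h / 2)
      have h3 : β ^ 2 / (2 * β - 1) * (2 * β - 1) = β ^ 2 := div_mul_cancel₀ _ h2
      simp only [hf, hg, hm, hs]
      generalize β ^ 2 / (2 * β - 1) = α at h3 ⊢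
      linear_combination (-χ x * χ y) * h3
    · simp only [hf, hg, hm, hn, hs, ht]
      field_simp
      ring
    · simp only [hf, hg, hm, hp, hs, ht]; ring
    · simp only [hf, hg, hm, hp, hs, ht]; ring
    · rcases hg with hg | hg
      · simp only [hf, hg, hm, hσmul, hσinv]; ring
      · simp only [hf, hg, hm, hσmul, hσinv]; ring
end

section
/- Let S be a semigroup and σ:S→S an involutive automorphism. If f,g:S→ℂ satisfy f(xσ(y)) = f(x)g(y) + f(y)g(x) − g(x)g(y) for all x,y∈S, then both f and g are abelian; that is, f(xy)=f(yx), g(xy)=g(yx), f(xyz)=f(xzy), and g(xyz)=g(xzy) for all x,y,z∈S. -/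
theorem aux_indep {S : Type*} [Semigroup S] (σ : S → S)
    (hσmul : ∀ x y : S, σ (x * y) = σ x * σ y) (hσinv : ∀ x : S, σ (σ x) = x)
    (f g : S → ℂ)
    (h : ∀ x y : S, f (x * σ y) = f x * g y + f y * g x - g x * g y)
    (H : ∀ c d : ℂ, (∀ x, c * f x + d * g x = 0) → c = 0 ∧ d = 0) :
    ∃ α γ : ℂ, ∀ y z : S,
      g (y * z) = α * (f y - g y) * (f z - g z) + g y * g z ∧
      f (y * z) = γ * (f y - g y) * (f z - g z) + (f z - g z) * g y + g z * f y := by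
  have H2 : ∀ c d c' d' : ℂ, (∀ x, c * f x + d * g x = c' * f x + d' * g x) →
      c = c' ∧ d = d' := by
    intro c d c' d' hh
    have := H (c - c') (d - d') (fun x => by linear_combination hh x)
    exact ⟨sub_eq_zero.1 this.1, sub_eq_zero.1 this.2⟩
  obtain ⟨z0, hz0⟩ : ∃ z, f z - g z ≠ 0 := by
    by_contra! hc
    have := H 1 (-1) (fun x => by linear_combination hc x)
    exact one_ne_zero this.1
  have E1 : ∀ x y z, (f z - g z) * g (x * σ y) =
      f x * g (y * z) + g x * (f (y * z) - g (y * z)) - g z * f (x * σ y) := by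
    intro x y z
    have h1 := h (x * σ y) z
    have h2 := h x (y * z)
    rw [hσmul, ← mul_assoc] at h2
    linear_combination h2 - h1
  obtain ⟨a, b, hab⟩ : ∃ a b : S → ℂ, ∀ x y, g (x * σ y) = f x * a y + g x * b y := by
    refine ⟨fun y => (g (y * z0) - g z0 * g y) / (f z0 - g z0),
      fun y => (f (y * z0) - g (y * z0) - g z0 * (f y - g y)) / (f z0 - g z0), fun x y => ?_⟩
    have := E1 x y z0
    rw [h x y] at this
    field_simp
    linear_combination this
  have E2 : ∀ y z, g (y * z) = (f z - g z) * a y + g y * g z ∧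
      f (y * z) - g (y * z) = (f z - g z) * b y + g z * (f y - g y) := by
    intro y z
    apply H2
    intro x
    have := E1 x y z
    rw [h x y, hab] at this
    linear_combination -this
  have hg : ∀ y z, g (y * z) = f y * a (σ z) + g y * b (σ z) := by
    intro y z
    have := hab y (σ z)
    rwa [hσinv] at this
  have hf : ∀ y z, f (y * z) = f y * g (σ z) + f (σ z) * g y - g y * g (σ z) := by
    intro y z
    have := h y (σ z)
    rwa [hσinv] at this
  obtain ⟨α, β, ha⟩ : ∃ α β : ℂ, ∀ y, a y = α * f y + β * g y := by
    refine ⟨a (σ z0) / (f z0 - g z0), (b (σ z0) - g z0) / (f z0 - g z0), fun y => ?_⟩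
    have := (E2 y z0).1
    rw [hg] at this
    field_simp
    linear_combination -this
  have E3 : ∀ z, a (σ z) = α * (f z - g z) ∧ b (σ z) = β * (f z - g z) + g z := by
    intro z
    apply H2
    intro y
    have := (E2 y z).1
    rw [hg, ha y] at this
    linear_combination this
  obtain ⟨p, q, hb⟩ : ∃ p q : ℂ, ∀ y, b y = p * f y + q * g y := by
    refine ⟨(g (σ z0) - g z0) / (f z0 - g z0) - α,
      (f (σ z0) - g (σ z0)) / (f z0 - g z0) - β, fun y => ?_⟩
    have h1 := (E2 y z0).1
    have h2 := (E2 y z0).2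
    have h3 := hf y z0
    rw [ha y] at h1
    field_simp
    linear_combination -h1 - h2 + h3
  have E4 : ∀ z, g (σ z) = g z + (α + p) * (f z - g z) ∧
      f (σ z) - g (σ z) = (β + q) * (f z - g z) := by
    intro z
    apply H2
    intro y
    have h1 := (E2 y z).1
    have h2 := (E2 y z).2
    have h3 := hf y z
    rw [ha y] at h1
    rw [hb y] at h2
    linear_combination h1 + h2 - h3
  have E5 := H2 (p * (β + q) + (p + q) * (α + p))
    ((p + q) - (p * (β + q) + (p + q) * (α + p))) β (1 - β) (by
      intro z
      have h1 := (E3 z).2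
      rw [hb] at h1
      linear_combination h1 - p * (E4 z).2 - (p + q) * (E4 z).1)
  have E6 := H2 (α * (β + q) + (α + β) * (α + p))
    ((α + β) - (α * (β + q) + (α + β) * (α + p))) α (- α) (by
      intro z
      have h1 := (E3 z).1
      rw [ha] at h1
      linear_combination h1 - α * (E4 z).2 - (α + β) * (E4 z).1)
  have s1 : p + q = 1 := by linear_combination E5.1 + E5.2
  have s2 : α + β = 0 := by linear_combination E6.1 + E6.2
  refine ⟨α, α + p, fun y z => ?_⟩
  have h1 := (E2 y z).1
  have h2 := (E2 y z).2
  rw [ha y] at h1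
  rw [hb y] at h2
  constructor
  · linear_combination h1 + (f z - g z) * g y * s2
  · linear_combination h1 + h2 + (f z - g z) * g y * (s1 + s2)

/-- any solution of `f(xσ(y)) = f(x)g(y) + f(y)g(x) − g(x)g(y)`
consists of abelian functions `f` and `g`. -/
theorem stmt_13 {S : Type*} [Semigroup S] (σ : S → S)
    (hσmul : ∀ x y : S, σ (x * y) = σ x * σ y) (hσinv : ∀ x : S, σ (σ x) = x)
    (f g : S → ℂ)
    (h : ∀ x y : S, f (x * σ y) = f x * g y + f y * g x - g x * g y) :
    (∀ x y : S, f (x * y) = f (y * x)) ∧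
    (∀ x y : S, g (x * y) = g (y * x)) ∧
    (∀ x y z : S, f (x * y * z) = f (x * z * y)) ∧
    (∀ x y z : S, g (x * y * z) = g (x * z * y)) := by
  by_cases hf0 : ∀ x, f x = 0
  · have hg0 : ∀ x, g x = 0 := by
      intro x
      have := h x x
      simp only [hf0] at this
      have h2 : g x * g x = 0 := by linear_combination this
      exact mul_self_eq_zero.1 h2
    simp [hf0, hg0]
  by_cases hd : ∃ c, ∀ x, g x = c * f x
  · obtain ⟨c, hc⟩ := hd
    obtain ⟨k, hk⟩ : ∃ k, k = 2 * c - c ^ 2 := ⟨_, rfl⟩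
    have hm : ∀ x y, f (x * y) = k * f x * f (σ y) := by
      intro x y
      have := h x (σ y)
      rw [hσinv, hc, hc] at this
      rw [this, hk]; ring
    have hF : ∀ x y, f (x * y) = k * f x * f y := by
      by_cases hk0 : k = 0
      · intro x y; rw [hm, hk0]; ring
      · push Not at hf0
        obtain ⟨x0, hx0⟩ := hf0
        obtain ⟨y0, hy0⟩ : ∃ y, f (σ y) ≠ 0 := ⟨σ x0, by rwa [hσinv]⟩
        intro x z
        have h1 := hm x0 (y0 * z)
        rw [hσmul, hm (σ y0), hσinv, ← mul_assoc x0, hm (x0 * y0), hm x0] at h1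
        have h2 : f (σ z) = f z := by
          have h3 : k * k * f x0 * f (σ y0) ≠ 0 := by simp [hk0, hx0, hy0]
          apply mul_left_cancel₀ h3
          linear_combination h1
        rw [hm, h2]
    simp only [hc, hF]
    refine ⟨?_, ?_, ?_, ?_⟩ <;> intros <;> ring
  · have H : ∀ c d : ℂ, (∀ x, c * f x + d * g x = 0) → c = 0 ∧ d = 0 := by
      intro c d hcd
      have hd0 : d = 0 := by
        by_contra hdn
        apply hd
        refine ⟨-c / d, fun x => ?_⟩
        field_simp
        linear_combination hcd x
      refine ⟨?_, hd0⟩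
      by_contra hcn
      apply hf0
      intro x
      have := hcd x
      simpa [hd0, hcn] using this
    obtain ⟨α, γ, hh⟩ := aux_indep σ hσmul hσinv f g h H
    have hG := fun y z => (hh y z).1
    have hF := fun y z => (hh y z).2
    simp only [hG, hF]
    refine ⟨?_, ?_, ?_, ?_⟩ <;> intros <;> ring
end

section
/- Let S be a semigroup and σ:S→S an involutive automorphism. If f,g:S→ℂ are linearly independent functions satisfying f(xσ(y)) = f(x)g(y) + f(y)g(x) − g(x)g(y) for all x,y∈S, then f∘σ = f. -/
theorem dep_aux {S : Type*} (p q : S → ℂ) (σ : S → S) (s : ℂ)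
    (hp : ∀ x, p (σ x) = s * p x) (hq : ∀ x, q (σ x) = s * q x)
    (hd : ¬ ∀ a b : ℂ, (∀ x, a * p x + b * q x = 0) → a = 0 ∧ b = 0) :
    ∃ (e : S → ℂ) (a b : ℂ), (∀ x, e (σ x) = s * e x) ∧ (∀ x, p x = a * e x) ∧
      (∀ x, q x = b * e x) := by
  push Not at hd
  obtain ⟨a, b, h1, h2⟩ := hd
  by_cases ha : a = 0
  · refine ⟨p, 1, 0, hp, fun x => by ring, fun x => ?_⟩
    have := h1 x
    have hb := h2 ha
    simp only [ha, zero_mul, zero_add, mul_eq_zero, hb, false_or] at this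
    rw [this]; ring
  · refine ⟨q, -b / a, 1, hq, fun x => ?_, fun x => by ring⟩
    have := h1 x
    field_simp
    linear_combination this

/-- linearly independent solutions of
`f(xσ(y)) = f(x)g(y) + f(y)g(x) − g(x)g(y)` satisfy `f ∘ σ = f`. -/
theorem stmt_14 {S : Type*} [Semigroup S] (σ : S → S)
    (hσmul : ∀ x y : S, σ (x * y) = σ x * σ y) (hσinv : ∀ x : S, σ (σ x) = x)
    (f g : S → ℂ) (hind : LinearIndependent ℂ ![f, g])
    (h : ∀ x y : S, f (x * σ y) = f x * g y + f y * g x - g x * g y) :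
    ∀ x : S, f (σ x) = f x := by
  have ind0 : ∀ p q : ℂ, (∀ x, p * f x + q * g x = 0) → p = 0 ∧ q = 0 := by
    intro p q hpq
    exact LinearIndependent.pair_iff.1 hind p q (by ext x; simpa using hpq x)
  obtain ⟨u, hu⟩ : ∃ u : S → ℂ, ∀ x, u x = f x - g x / 2 := ⟨_, fun _ => rfl⟩
  have ind : ∀ p q : ℂ, (∀ x, p * u x + q * g x = 0) → p = 0 ∧ q = 0 := by
    intro p q hpq
    obtain ⟨h1, h2⟩ := ind0 p (q - p / 2) (fun x => by
      have := hpq x; rw [hu] at this; linear_combination this)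
    exact ⟨h1, by linear_combination h2 + h1 / 2⟩
  have hB : ∀ x y, f (x * σ y) = u x * g y + g x * u y := by
    intro x y; rw [h, hu, hu]; ring
  -- f vanishing on S^2 or S^3 is impossible
  have K : ∀ (_ : ∀ x y, f (x * y) = 0), False := by
    intro hz
    have : ∀ x, g x = 0 := fun x => (ind (g x) (u x) (fun y => by
      have := hB x y; rw [hz] at this; linear_combination -this)).1
    have := (ind 0 1 (fun x => by rw [this]; ring)).2
    exact one_ne_zero this
  have K3 : ∀ (_ : ∀ x y z, f (x * y * z) = 0), False := by
    intro hz
    apply K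
    intro x y
    have := ind (g (x * y)) (u (x * y)) (fun z => by
      have := hB (x * y) z; rw [hz] at this; linear_combination -this)
    have h3 := hu (x * y)
    rw [this.1, this.2] at h3
    linear_combination -h3
  have sw : ∀ x y, f (x * y) = f (σ y * σ x) := by
    intro x y
    have h1 := hB x (σ y)
    have h2 := hB (σ y) x
    rw [hσinv] at h1
    rw [h1, h2]; ring
  have cyc : ∀ x y z, f (x * y * z) = f (y * z * x) := by
    intro x y z
    rw [sw (x * y) z, hσmul, ← mul_assoc, sw, hσmul, hσinv, hσinv, hσinv, mul_assoc]
  have ev3 : ∀ x y z, f (σ (x * y * z)) = f (x * y * z) := by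
    intro x y z
    rw [mul_assoc x y z, sw x (y * z), hσmul, hσmul, ← mul_assoc, cyc]
  obtain ⟨ge, hge⟩ : ∃ e : S → ℂ, ∀ x, e x = (g x + g (σ x)) / 2 := ⟨_, fun _ => rfl⟩
  obtain ⟨go, hgo⟩ : ∃ e : S → ℂ, ∀ x, e x = (g x - g (σ x)) / 2 := ⟨_, fun _ => rfl⟩
  obtain ⟨ue, hue⟩ : ∃ e : S → ℂ, ∀ x, e x = (u x + u (σ x)) / 2 := ⟨_, fun _ => rfl⟩
  obtain ⟨uo, huo⟩ : ∃ e : S → ℂ, ∀ x, e x = (u x - u (σ x)) / 2 := ⟨_, fun _ => rfl⟩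
  have ge_s : ∀ x, ge (σ x) = 1 * ge x := fun x => by rw [hge, hge, hσinv]; ring
  have go_s : ∀ x, go (σ x) = (-1) * go x := fun x => by rw [hgo, hgo, hσinv]; ring
  have ue_s : ∀ x, ue (σ x) = 1 * ue x := fun x => by rw [hue, hue, hσinv]; ring
  have uo_s : ∀ x, uo (σ x) = (-1) * uo x := fun x => by rw [huo, huo, hσinv]; ring
  have gd : ∀ x, g x = ge x + go x := fun x => by rw [hge, hgo]; ring
  have ud : ∀ x, u x = ue x + uo x := fun x => by rw [hue, huo]; ring
  have fd : ∀ x, f x = (ue x + ge x / 2) + (uo x + go x / 2) := fun x => by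
    have h1 := hu x
    rw [ud, gd] at h1
    linear_combination -h1
  have fds : ∀ x, f (σ x) = (ue x + ge x / 2) - (uo x + go x / 2) := fun x => by
    rw [fd, ge_s, go_s, ue_s, uo_s]; ring
  have key : ∀ x y, f (x * σ y) - f (σ (x * σ y)) =
      2 * (uo x * ge y + ue x * go y + go x * ue y + ge x * uo y) := by
    intro x y
    rw [hσmul, hB, hB, gd, gd, gd, gd, ud, ud, ud, ud, ge_s, go_s, ue_s, uo_s,
      ge_s, go_s, ue_s, uo_s]
    ring
  have par : ∀ x, (∀ y, f (x * σ y) - f (σ (x * σ y)) = 0) →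
      ∀ y, uo x * ge y + go x * ue y = 0 ∧ ge x * uo y + ue x * go y = 0 := by
    intro x hx y
    have h1 := key x y
    have h2 := key x (σ y)
    rw [hx] at h1 h2
    rw [ge_s, go_s, ue_s, uo_s] at h2
    constructor
    · linear_combination -h1/4 - h2/4
    · linear_combination -h1/4 + h2/4
  have par2 : ∀ x w y, uo (x * w) * ge y + go (x * w) * ue y = 0 ∧
      ge (x * w) * uo y + ue (x * w) * go y = 0 := by
    intro x w
    apply par
    intro y
    rw [ev3]; ring
  by_cases c1 : ∀ a b : ℂ, (∀ x, a * ge x + b * ue x = 0) → a = 0 ∧ b = 0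
  · have z2 : ∀ x w, uo (x * w) = 0 ∧ go (x * w) = 0 := fun x w =>
      c1 _ _ (fun y => (par2 x w y).1)
    intro x
    have := c1 (uo x) (go x) (fun y => (par x (fun y => by
      rw [fds, fd, (z2 _ _).1, (z2 _ _).2]; ring) y).1)
    rw [fds, fd, this.1, this.2]; ring
  by_cases c2 : ∀ a b : ℂ, (∀ x, a * go x + b * uo x = 0) → a = 0 ∧ b = 0
  · exfalso
    have z2 : ∀ x w, ue (x * w) = 0 ∧ ge (x * w) = 0 := fun x w =>
      c2 _ _ (fun y => by linear_combination (par2 x w y).2)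
    apply K3
    intro x y z
    have h1 := ev3 x y z
    rw [fds, fd, (z2 _ _).1, (z2 _ _).2] at h1
    rw [fd, (z2 _ _).1, (z2 _ _).2]
    linear_combination -h1/2
  obtain ⟨e, a, b, e_s, ha, hb⟩ := dep_aux ge ue σ 1 ge_s ue_s c1
  obtain ⟨o, c, d, o_s, hc, hd⟩ := dep_aux go uo σ (-1) go_s uo_s c2
  simp only [ha, hb, hc, hd] at *
  by_cases hs : a * d + b * c = 0
  swap
  · exfalso
    by_cases hoz : ∀ y, o y = 0
    · have := ind a (-b) (fun x => by rw [ud, gd, hoz]; ring)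
      apply hs
      linear_combination d * this.1 - c * this.2
    by_cases hez : ∀ y, e y = 0
    · have := ind c (-d) (fun x => by rw [ud, gd, hez]; ring)
      apply hs
      linear_combination b * this.1 - a * this.2
    push Not at hoz hez
    obtain ⟨y, hy⟩ := hoz
    obtain ⟨z, hz⟩ := hez
    apply K
    intro x w
    have h1 : (a * d + b * c) * e z * o (x * w) = 0 := by
      linear_combination (par2 x w z).1
    have h2 : (a * d + b * c) * o y * e (x * w) = 0 := by
      linear_combination (par2 x w y).2
    have h1' := (mul_eq_zero.1 h1).resolve_left (mul_ne_zero hs hz)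
    have h2' := (mul_eq_zero.1 h2).resolve_left (mul_ne_zero hs hy)
    rw [fd, h1', h2']; ring
  -- remaining case
  have o2 : ∀ x w, (d + c / 2) * o (x * w) = 0 := by
    intro x w
    have h1 := key x (σ w)
    rw [hσinv, fds, fd, e_s, o_s] at h1
    linear_combination h1 / 2 + (e x * (-1) * o w + o x * e w) * hs
  by_cases hdc : d + c / 2 = 0
  · intro x; rw [fds, fd]; linear_combination (-2) * o x * hdc
  have o2' : ∀ x w, o (x * w) = 0 := fun x w => (mul_eq_zero.1 (o2 x w)).resolve_left hdc
  have hk : b + a / 2 ≠ 0 := by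
    intro hk
    apply K
    intro x w
    rw [fd, o2']; linear_combination e (x * w) * hk
  have em : ∀ x y, (b + a / 2) * e (x * y) = 2 * a * b * e x * e y - 2 * c * d * o x * o y := by
    intro x y
    have h1 := hB x (σ y)
    rw [hσinv, fd, o2', gd, gd, ud, ud, e_s, o_s] at h1
    linear_combination h1 + (o x * e y - e x * o y) * hs
  have as : ∀ x y z, a * b * c * d * (o y * (e z * o x - e x * o z)) = 0 := by
    intro x y z
    have h1 := em (x * y) z
    have h2 := em x (y * z)
    have h3 := em x y
    have h4 := em y z
    rw [o2'] at h1 h2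
    rw [mul_assoc] at h1
    linear_combination (-1) * (-(b + a/2) * h1 + (b + a/2) * h2 - 2 * a * b * e z * h3
      + 2 * a * b * e x * h4) / 4
  by_cases hoz : ∀ y, o y = 0
  · intro x; rw [fds, fd, hoz]; ring
  exfalso
  push Not at hoz
  obtain ⟨y, hy⟩ := hoz
  have had : a * d ≠ 0 := by
    intro had
    have hbc : b * c = 0 := by linear_combination hs - had
    obtain ⟨h1, h2⟩ := ind c (-d) (fun x => by
      rw [ud, gd]; linear_combination e x * (hbc - had))
    apply hdc
    linear_combination h1/2 - h2
  have hbc : b * c ≠ 0 := fun hbc => had (by linear_combination hs - hbc)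
  have hn : a * b * c * d ≠ 0 := by
    have := mul_ne_zero had hbc
    intro hh; apply this; linear_combination hh
  have ez : ∀ z, e z = 0 := by
    intro z
    have h1 := ((mul_eq_zero.1 ((mul_eq_zero.1 (as y y z)).resolve_left hn))).resolve_left hy
    have h2 := ((mul_eq_zero.1 ((mul_eq_zero.1 (as y y (σ z))).resolve_left hn))).resolve_left hy
    rw [e_s, o_s] at h2
    have h3 : e z * o y = 0 := by linear_combination h1/2 + h2/2
    exact (mul_eq_zero.1 h3).resolve_right hy
  apply K
  intro x w
  rw [fd, o2', ez]; ring
end
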